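/- Consider the two-block undirected stochastic blockmodel with connectivity matrix B = [[a, b],[b, a]] where 0 < b < a < 1, membership probability vector π = (π_1, 1−π_1) with 0 < π_1 < 1, and dense regime ρ_∞ = 1. Then the asymptotic covariance matrix from Theorem 1 for block ℓ = 2, namely Σ_2 = {diag(π)^{-1/2} T_B^{-1} J Δ_X^{-1}} · E_ξ[g_1(ξ, T_B e_2)] · {Δ_X^{-1} J (T_B^{-1})^T diag(π)^{-1/2}}, is the symmetric 2×2 matrix with entries Σ_2[1,1] = (a b^2 π_1 + a^2 b(1−b−π_1)) / ((a^2−b^2)^2 π_1^2 (1−π_1)), Σ_2[1,2] = Σ_2[2,1] = −ab(b(1−b) + (a−b)(1−a−b)π_1) / ((a^2−b^2)^2 (π_1(1−π_1))^{3/2}), and Σ_2[2,2] = (a^3(1−a)π_1 + b^3(1−b)(1−π_1)) / ((a^2−b^2)^2 π_1 (1−π_1)^2). -/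

import Mathlib

open Matrix

/-- `g_1(ξ, x) = (xᵀ J ξ)(1 − xᵀ J ξ) ξ ξᵀ` with `J = I₂` (dense regime `ρ_∞ = 1`). -/
noncomputable def gOne (ξ x : Fin 2 → ℝ) : Matrix (Fin 2) (Fin 2) ℝ :=
  ((x ⬝ᵥ ξ) * (1 - x ⬝ᵥ ξ)) • Matrix.vecMulVec ξ ξ

/-- Algebraic reduction: all factors of `T` cancel except `B⁻¹ = (Tᵀ T)⁻¹`. -/
theorem sandwich_reduce (T D M P E Bi : Matrix (Fin 2) (Fin 2) ℝ) (hT : IsUnit T.det)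
    (hD : D * E = 1) (hB : Tᵀ * T * Bi = 1) :
    (P * T⁻¹ * 1 * (T * D * Tᵀ)⁻¹) * (T * M * Tᵀ) * ((T * D * Tᵀ)⁻¹ * 1 * (T⁻¹)ᵀ * P)
      = P * Bi * E * M * E * Bi * P := by
  have hE : D⁻¹ = E := Matrix.inv_eq_right_inv hD
  have hBi : T⁻¹ * (Tᵀ)⁻¹ = Bi := by
    rw [← Matrix.mul_inv_rev]; exact Matrix.inv_eq_right_inv hB
  have hTt : IsUnit (Tᵀ).det := by rwa [Matrix.det_transpose]
  have h1 : T⁻¹ * T = 1 := Matrix.nonsing_inv_mul T hT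
  have h2 : Tᵀ * (Tᵀ)⁻¹ = 1 := Matrix.mul_nonsing_inv _ hTt
  rw [Matrix.mul_inv_rev, Matrix.mul_inv_rev, hE, Matrix.transpose_nonsing_inv]
  calc _ = P * (T⁻¹ * (Tᵀ)⁻¹) * E * (T⁻¹ * T) * M * (Tᵀ * (Tᵀ)⁻¹) * E
        * (T⁻¹ * (Tᵀ)⁻¹) * P := by simp only [Matrix.mul_assoc, Matrix.mul_one, Matrix.one_mul]
    _ = _ := by rw [hBi, h1, h2]; simp only [Matrix.mul_one]

/-- A mixture of rank-one matrices built from the columns of `T`. -/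
theorem rank_one_mix (T : Matrix (Fin 2) (Fin 2) ℝ) (p q : ℝ) :
    p • Matrix.vecMulVec (T.mulVec ![1, 0]) (T.mulVec ![1, 0])
      + q • Matrix.vecMulVec (T.mulVec ![0, 1]) (T.mulVec ![0, 1])
      = T * Matrix.diagonal ![p, q] * Tᵀ := by
  ext i j
  fin_cases i <;> fin_cases j <;>
    simp [Matrix.mul_apply, Matrix.vecMulVec_apply, Matrix.mulVec, dotProduct, Fin.sum_univ_two,
      Matrix.diagonal_apply] <;> ring

/-- In the two-block undirected stochastic blockmodel with
`B = [[a,b],[b,a]]`, `0 < b < a < 1`, membership probabilities `(π₁, 1−π₁)`, and dense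
regime `ρ_∞ = 1`, the asymptotic covariance matrix of Theorem 1 for block `ℓ = 2` has the
stated closed form. -/
theorem block_two_covariance_closed_form
    (a b π₁ : ℝ) (hb : 0 < b) (hba : b < a) (ha : a < 1)
    (hπ₁ : 0 < π₁) (hπ₁' : π₁ < 1) :
    let UB : Matrix (Fin 2) (Fin 2) ℝ := (Real.sqrt 2)⁻¹ • !![1, 1; 1, -1]
    let TB : Matrix (Fin 2) (Fin 2) ℝ :=
      Matrix.diagonal ![Real.sqrt (a + b), Real.sqrt (a - b)] * UBᵀ
    let J : Matrix (Fin 2) (Fin 2) ℝ := 1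
    let ξ₁ : Fin 2 → ℝ := TB.mulVec ![1, 0]
    let ξ₂ : Fin 2 → ℝ := TB.mulVec ![0, 1]
    let ΔX : Matrix (Fin 2) (Fin 2) ℝ :=
      π₁ • Matrix.vecMulVec ξ₁ ξ₁ + (1 - π₁) • Matrix.vecMulVec ξ₂ ξ₂
    let Eg : (Fin 2 → ℝ) → Matrix (Fin 2) (Fin 2) ℝ := fun x =>
      π₁ • gOne ξ₁ x + (1 - π₁) • gOne ξ₂ x
    let Dπ : Matrix (Fin 2) (Fin 2) ℝ :=
      Matrix.diagonal ![(Real.sqrt π₁)⁻¹, (Real.sqrt (1 - π₁))⁻¹]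
    let Sig2 : Matrix (Fin 2) (Fin 2) ℝ :=
      (Dπ * TB⁻¹ * J * ΔX⁻¹) * Eg ξ₂ * (ΔX⁻¹ * J * (TB⁻¹)ᵀ * Dπ)
    Sig2 = !![(a * b ^ 2 * π₁ + a ^ 2 * b * (1 - b - π₁)) /
                ((a ^ 2 - b ^ 2) ^ 2 * π₁ ^ 2 * (1 - π₁)),
              -(a * b * (b * (1 - b) + (a - b) * (1 - a - b) * π₁)) /
                ((a ^ 2 - b ^ 2) ^ 2 * (π₁ * (1 - π₁)) ^ ((3 : ℝ) / 2));
              -(a * b * (b * (1 - b) + (a - b) * (1 - a - b) * π₁)) /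
                ((a ^ 2 - b ^ 2) ^ 2 * (π₁ * (1 - π₁)) ^ ((3 : ℝ) / 2)),
              (a ^ 3 * (1 - a) * π₁ + b ^ 3 * (1 - b) * (1 - π₁)) /
                ((a ^ 2 - b ^ 2) ^ 2 * π₁ * (1 - π₁) ^ 2)] := by
  intro UB TB J ξ₁ ξ₂ ΔX Eg Dπ Sig2
  have hq : 0 < 1 - π₁ := by linarith
  have hab : 0 < a + b := by linarith
  have hamb : 0 < a - b := by linarith
  have hd : a ^ 2 - b ^ 2 ≠ 0 := by
    have := mul_pos hab hamb
    nlinarith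
  have s2 : (Real.sqrt 2)⁻¹ * (Real.sqrt 2)⁻¹ = 1 / 2 := by
    rw [← mul_inv, Real.mul_self_sqrt (by norm_num)]; norm_num
  have hTB : TB = !![Real.sqrt (a + b) * (Real.sqrt 2)⁻¹, Real.sqrt (a + b) * (Real.sqrt 2)⁻¹;
      Real.sqrt (a - b) * (Real.sqrt 2)⁻¹, -(Real.sqrt (a - b) * (Real.sqrt 2)⁻¹)] := by
    ext i j
    fin_cases i <;> fin_cases j <;> simp [TB, UB]
  have sp := Real.mul_self_sqrt hab.le
  have sm := Real.mul_self_sqrt hamb.le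
  have hTT : TBᵀ * TB = !![a, b; b, a] := by
    rw [hTB]
    generalize (Real.sqrt 2)⁻¹ = r at *
    generalize Real.sqrt (a + b) = u at *
    generalize Real.sqrt (a - b) = v at *
    ext i j
    fin_cases i <;> fin_cases j <;>
      simp [Matrix.mul_apply, Fin.sum_univ_two]
    · linear_combination (r * r) * sp + (r * r) * sm + (2 * a) * s2
    · linear_combination (r * r) * sp - (r * r) * sm + (2 * b) * s2
    · linear_combination (r * r) * sp - (r * r) * sm + (2 * b) * s2
    · linear_combination (r * r) * sp + (r * r) * sm + (2 * a) * s2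
  have hdet : IsUnit TB.det := by
    have h := congrArg Matrix.det hTT
    rw [Matrix.det_mul, Matrix.det_transpose, Matrix.det_fin_two_of] at h
    rw [isUnit_iff_ne_zero]
    intro h0
    rw [h0] at h
    apply hd
    linarith
  have e21 : ξ₂ ⬝ᵥ ξ₁ = b := by
    have h := congrFun (congrFun hTT 1) 0
    simp [Matrix.mul_apply, Fin.sum_univ_two] at h
    simpa [ξ₁, ξ₂, Matrix.mulVec, dotProduct, Fin.sum_univ_two] using h
  have e22 : ξ₂ ⬝ᵥ ξ₂ = a := by
    have h := congrFun (congrFun hTT 1) 1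
    simp [Matrix.mul_apply, Fin.sum_univ_two] at h
    simpa [ξ₁, ξ₂, Matrix.mulVec, dotProduct, Fin.sum_univ_two] using h
  have hΔ : ΔX = TB * Matrix.diagonal ![π₁, 1 - π₁] * TBᵀ := rank_one_mix TB _ _
  have hEg : Eg ξ₂ = TB * Matrix.diagonal ![π₁ * (b * (1 - b)), (1 - π₁) * (a * (1 - a))]
      * TBᵀ := by
    rw [← rank_one_mix]
    simp only [Eg, gOne, e21, e22, smul_smul]
    rfl
  have hS : Sig2 = Dπ *
      !![a / (a ^ 2 - b ^ 2), -b / (a ^ 2 - b ^ 2); -b / (a ^ 2 - b ^ 2), a / (a ^ 2 - b ^ 2)] *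
      Matrix.diagonal ![π₁⁻¹, (1 - π₁)⁻¹] *
      Matrix.diagonal ![π₁ * (b * (1 - b)), (1 - π₁) * (a * (1 - a))] *
      Matrix.diagonal ![π₁⁻¹, (1 - π₁)⁻¹] *
      !![a / (a ^ 2 - b ^ 2), -b / (a ^ 2 - b ^ 2); -b / (a ^ 2 - b ^ 2), a / (a ^ 2 - b ^ 2)] *
      Dπ := by
    change (Dπ * TB⁻¹ * 1 * ΔX⁻¹) * Eg ξ₂ * (ΔX⁻¹ * 1 * (TB⁻¹)ᵀ * Dπ) = _
    rw [hΔ, hEg]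
    exact sandwich_reduce TB _ _ Dπ (Matrix.diagonal ![π₁⁻¹, (1 - π₁)⁻¹])
      !![a / (a ^ 2 - b ^ 2), -b / (a ^ 2 - b ^ 2); -b / (a ^ 2 - b ^ 2), a / (a ^ 2 - b ^ 2)]
      hdet
      (by
        ext i j
        fin_cases i <;> fin_cases j <;> simp [hπ₁.ne', hq.ne'])
      (by
        rw [hTT]
        ext i j
        fin_cases i <;> fin_cases j <;> simp [Matrix.mul_apply, Fin.sum_univ_two] <;>
          field_simp <;> ring)
  rw [hS]
  have hpow : (π₁ * (1 - π₁)) ^ ((3 : ℝ) / 2)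
      = π₁ * (1 - π₁) * (Real.sqrt π₁ * Real.sqrt (1 - π₁)) := by
    rw [← Real.sqrt_mul hπ₁.le, Real.sqrt_eq_rpow,
      show (3 : ℝ) / 2 = 1 + 1 / 2 by norm_num, Real.rpow_add (mul_pos hπ₁ hq), Real.rpow_one]
  rw [hpow]
  have t1 := Real.sq_sqrt hπ₁.le
  have t2 := Real.sq_sqrt hq.le
  have n1 := (Real.sqrt_pos.mpr hπ₁).ne'
  have n2 := (Real.sqrt_pos.mpr hq).ne'
  have hp0 := hπ₁.ne'
  have hq0 := hq.ne'
  simp only [Dπ]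
  clear_value Sig2
  generalize Real.sqrt π₁ = u at *
  generalize Real.sqrt (1 - π₁) = v at *
  ext i j
  fin_cases i <;> fin_cases j <;>
    simp [Matrix.mul_apply, Fin.sum_univ_two, Matrix.diagonal_apply] <;>
    field_simp <;> (try simp only [t1, t2]) <;> (try field_simp) <;> ring
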